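/- Let Φ : ℝ^N → ℝ^N be a map assigning to every arrival vector a a departure vector Φ(a) such that (a, Φ(a)) satisfies the dynamics, and define c(a) = ∑_{i=1}^N ((Φ(a)_i − d*_i)² + γ(Φ(a)_i − a_i)). For any a ∈ ℝ^N, let O(a) denote the nondecreasing rearrangement of a. Then c(O(a)) ≤ c(a). -/

import Mathlib

open MeasureTheory Finset

/-- `(a, d)` satisfies the linear-slowdown processor-sharing dynamics. -/
def SlowdownDynamics (N : ℕ) (α β : ℝ) (a d : Fin N → ℝ) : Prop :=
  (∀ i, a i < d i) ∧
  ∀ i : Fin N,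
    (∫ t in (a i)..(d i),
      (β - α * ((∑ j : Fin N, if t ∈ Set.Icc (a j) (d j) then (1 : ℝ) else 0) - 1))) = 1

/-- The service rate at time `t` when user `j` is present during `[a j, d j]`. -/
noncomputable def serviceRate (N : ℕ) (α β : ℝ) (a d : Fin N → ℝ) (t : ℝ) : ℝ :=
  β - α * ((∑ j : Fin N, if t ∈ Set.Icc (a j) (d j) then (1 : ℝ) else 0) - 1)

lemma serviceRate_pos {N : ℕ} {α β : ℝ} (hα : 0 < α) (hstab : 0 < β - α * ((N : ℝ) - 1))
    (a d : Fin N → ℝ) (t : ℝ) : 0 < serviceRate N α β a d t := by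
  have h : (∑ j : Fin N, if t ∈ Set.Icc (a j) (d j) then (1 : ℝ) else 0) ≤ N := by
    calc _ ≤ ∑ _j : Fin N, (1 : ℝ) := sum_le_sum fun j _ => by split_ifs <;> norm_num
      _ = N := by simp
  unfold serviceRate
  nlinarith

lemma intervalIntegrable_serviceRate (N : ℕ) (α β : ℝ) (a d : Fin N → ℝ) (x y : ℝ) :
    IntervalIntegrable (serviceRate N α β a d) volume x y := by
  have h : ∀ j : Fin N, IntervalIntegrable
      (fun t => if t ∈ Set.Icc (a j) (d j) then (1 : ℝ) else 0) volume x y := fun j => by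
    have : Integrable ((Set.Icc (a j) (d j)).indicator fun _ => (1 : ℝ)) :=
      (integrable_indicator_iff measurableSet_Icc).2 (integrableOn_const (by simp))
    convert this.intervalIntegrable using 1
    ext t
    simp [Set.indicator_apply]
  have hsum : IntervalIntegrable
      (fun t => ∑ j : Fin N, if t ∈ Set.Icc (a j) (d j) then (1 : ℝ) else 0) volume x y := by
    simpa only [Finset.sum_apply, Finset.sum_fn] using
      IntervalIntegrable.sum univ (fun j _ => h j)
  exact intervalIntegrable_const.sub
    ((hsum.sub intervalIntegrable_const).const_mul α)

lemma integral_serviceRate_pos {N : ℕ} {α β : ℝ} (hα : 0 < α)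
    (hstab : 0 < β - α * ((N : ℝ) - 1)) (a d : Fin N → ℝ) {x y : ℝ} (hxy : x < y) :
    0 < ∫ t in x..y, serviceRate N α β a d t :=
  intervalIntegral.intervalIntegral_pos_of_pos (intervalIntegrable_serviceRate N α β a d x y)
    (serviceRate_pos hα hstab a d) hxy

namespace SlowdownDynamics

variable {N : ℕ} {α β : ℝ} {a d d' : Fin N → ℝ}

lemma integral_serviceRate (h : SlowdownDynamics N α β a d) (i : Fin N) :
    ∫ t in (a i)..(d i), serviceRate N α β a d t = 1 :=
  h.2 i

/-- Users depart in their order of arrival. -/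
lemma departure_le (hα : 0 < α) (hstab : 0 < β - α * ((N : ℝ) - 1))
    (h : SlowdownDynamics N α β a d) {i j : Fin N} (hij : a i ≤ a j) : d i ≤ d j := by
  by_contra! hlt
  have hint := intervalIntegrable_serviceRate N α β a d
  have h₁ := intervalIntegral.integral_add_adjacent_intervals
    (hint (a i) (a j)) (hint (a j) (d j))
  have h₂ := intervalIntegral.integral_add_adjacent_intervals
    (hint (a i) (d j)) (hint (d j) (d i))
  have h₃ := intervalIntegral.integral_nonneg (μ := volume) hij
    fun t _ => (serviceRate_pos hα hstab a d t).le
  have h₄ := integral_serviceRate_pos hα hstab a d hlt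
  linarith [h.integral_serviceRate i, h.integral_serviceRate j]

/-- If all departures before `d i` agree, then user `i` cannot leave later in the second
solution than in the first. -/
lemma not_departure_lt_of_forall (hα : 0 < α) (hstab : 0 < β - α * ((N : ℝ) - 1))
    (h : SlowdownDynamics N α β a d) (h' : SlowdownDynamics N α β a d') {i : Fin N}
    (hmin : ∀ j, d j ≠ d' j → d i ≤ d j ∧ d i ≤ d' j) : ¬ d i < d' i := by
  intro hlt
  have hint := intervalIntegrable_serviceRate N α β a d'
  have hcongr : ∫ t in (a i)..(d i), serviceRate N α β a d' t =
      ∫ t in (a i)..(d i), serviceRate N α β a d t := by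
    refine intervalIntegral.integral_congr fun t ht => ?_
    rw [Set.uIcc_of_le (h.1 i).le] at ht
    have : ∀ j, (t ∈ Set.Icc (a j) (d' j) ↔ t ∈ Set.Icc (a j) (d j)) := fun j => by
      by_cases hj : d j = d' j
      · rw [hj]
      · have := hmin j hj
        simp [ht.2.trans this.1, ht.2.trans this.2]
    simp only [serviceRate, this]
  have h₁ := intervalIntegral.integral_add_adjacent_intervals
    (hint (a i) (d i)) (hint (d i) (d' i))
  have h₂ := integral_serviceRate_pos hα hstab a d' hlt
  linarith [h.integral_serviceRate i, h'.integral_serviceRate i]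

/-- The arrival times determine the departure times. -/
lemma departure_unique (hα : 0 < α) (hstab : 0 < β - α * ((N : ℝ) - 1))
    (h : SlowdownDynamics N α β a d) (h' : SlowdownDynamics N α β a d') : d = d' := by
  by_contra hne
  obtain ⟨k, hk⟩ := Function.ne_iff.1 hne
  obtain ⟨i, hi, hmin⟩ := (univ.filter fun j => d j ≠ d' j).exists_min_image
    (fun j => min (d j) (d' j)) ⟨k, by simpa using hk⟩
  simp only [mem_filter, mem_univ, true_and] at hi hmin
  rcases lt_or_gt_of_ne hi with hlt | hlt
  · refine not_departure_lt_of_forall hα hstab h h' (fun j hj => ?_) hlt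
    simpa [min_eq_left hlt.le] using hmin j hj
  · refine not_departure_lt_of_forall hα hstab h' h (fun j hj => ?_) hlt
    simpa [min_eq_right hlt.le, and_comm] using hmin j hj.symm

lemma comp_perm (h : SlowdownDynamics N α β a d) (σ : Equiv.Perm (Fin N)) :
    SlowdownDynamics N α β (a ∘ σ) (d ∘ σ) := by
  refine ⟨fun i => h.1 (σ i), fun i => ?_⟩
  have hsum : ∀ t : ℝ,
      (∑ j : Fin N, if t ∈ Set.Icc ((a ∘ σ) j) ((d ∘ σ) j) then (1 : ℝ) else 0) =
        ∑ j : Fin N, if t ∈ Set.Icc (a j) (d j) then (1 : ℝ) else 0 := fun t =>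
    Equiv.sum_comp σ fun j => if t ∈ Set.Icc (a j) (d j) then (1 : ℝ) else 0
  simp only [hsum]
  exact h.2 (σ i)

end SlowdownDynamics

/-- Replacing an arrival vector by its nondecreasing rearrangement does not
increase the total cost. -/
theorem sort_does_not_increase_cost
    (N : ℕ) (hN : 1 ≤ N) (α β : ℝ) (hα : 0 < α) (hβ : 0 < β)
    (hstab : 0 < β - α * ((N : ℝ) - 1))
    (dstar : Fin N → ℝ) (hdstar : Monotone dstar) (γ : ℝ) (hγ : 0 ≤ γ)
    (Φ : (Fin N → ℝ) → (Fin N → ℝ))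
    (hΦ : ∀ a : Fin N → ℝ, SlowdownDynamics N α β a (Φ a))
    (c : (Fin N → ℝ) → ℝ)
    (hc : ∀ a : Fin N → ℝ,
      c a = ∑ i : Fin N, ((Φ a i - dstar i) ^ 2 + γ * (Φ a i - a i)))
    (a b : Fin N → ℝ) (hperm : ∃ σ : Equiv.Perm (Fin N), b = a ∘ σ)
    (hb : Monotone b) :
    c b ≤ c a := by
  obtain ⟨σ, rfl⟩ := hperm
  have hΦσ : Φ (a ∘ σ) = Φ a ∘ σ :=
    (hΦ _).departure_unique hα hstab ((hΦ a).comp_perm σ)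
  have hmono : Monotone (Φ a ∘ σ) := fun i j hij =>
    (hΦ a).departure_le hα hstab (hb hij)
  have hrearr : ∑ i, Φ a i * dstar i ≤ ∑ i, Φ a (σ i) * dstar i := by
    simpa using (hmono.monovary hdstar).sum_comp_perm_mul_le_sum_mul (σ := σ⁻¹)
  have hsq : ∑ i, Φ a (σ i) ^ 2 = ∑ i, Φ a i ^ 2 := Equiv.sum_comp σ fun i => Φ a i ^ 2
  have hdelay : ∑ i, γ * (Φ a (σ i) - a (σ i)) = ∑ i, γ * (Φ a i - a i) :=
    Equiv.sum_comp σ fun i => γ * (Φ a i - a i)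
  have hexpand : ∀ D : Fin N → ℝ, ∑ i, (D i - dstar i) ^ 2 =
      ∑ i, D i ^ 2 - 2 * ∑ i, D i * dstar i + ∑ i, dstar i ^ 2 := fun D => by
    rw [mul_sum, ← sum_sub_distrib, ← sum_add_distrib]
    exact sum_congr rfl fun i _ => by ring
  have h₁ := hexpand (Φ a)
  have h₂ := hexpand (Φ a ∘ σ)
  simp only [Function.comp_apply] at h₂
  rw [hc, hc, hΦσ]
  simp only [Function.comp_apply, sum_add_distrib]
  linarith
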